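/- Node curvature is bounded by neighbouring three-point curvatures: Let γ be a unit-speed plane curve whose signed curvature k is nondecreasing on [s₁, s₅], let s₁ < s₂ < s₃ < s₄ < s₅, set Pᵢ = γ(sᵢ) (pairwise distinct) and vᵢ = P_{i+1} − Pᵢ. Assume each of the four arcs is one-to-one projectable onto its chord (⟨γ'(s), vᵢ/‖vᵢ‖⟩ > 0 for s ∈ [s_i, s_{i+1}], i = 1,…,4), and assume ‖v₁‖² + ⟨v₁, v₂⟩ ≥ 0 and ‖v₄‖² + ⟨v₃, v₄⟩ ≥ 0. Then the curvature of γ at the middle node satisfies q(P₁, P₂, P₃) ≤ k(s₃) ≤ q(P₃, P₄, P₅). -/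

import Mathlib

open scoped InnerProductSpace

/-- Planar cross product: `det((a₁,a₂),(b₁,b₂)) = a₁·b₂ − a₂·b₁`. -/
noncomputable def det2 (a b : EuclideanSpace ℝ (Fin 2)) : ℝ :=
  a 0 * b 1 - a 1 * b 0

/-- Signed curvature of a unit-speed plane curve: `k(s) = det(γ'(s), γ''(s))`. -/
noncomputable def signedCurv (γ : ℝ → EuclideanSpace ℝ (Fin 2)) (s : ℝ) : ℝ :=
  det2 (deriv γ s) (deriv (deriv γ) s)

/-- Signed curvature of the directed circle through three pairwise distinct
points `A`, `B`, `C`. -/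
noncomputable def q3 (A B C : EuclideanSpace ℝ (Fin 2)) : ℝ :=
  2 * det2 (B - A) (C - B) / (‖B - A‖ * ‖C - B‖ * ‖C - A‖)

/-- For a graph-like unit-speed curve over a horizontal chord, the sine of the slope angle equals
that of the circular arc of curvature `K` over the same chord at some point. -/
theorem exists_slope_eq_circle_slope {u v U V : ℝ → ℝ} {a b K : ℝ} (hab : a < b)
    (hu : ∀ s, HasDerivAt u (U s) s) (hv : ∀ s, HasDerivAt v (V s) s)
    (hUV : ∀ s, U s ^ 2 + V s ^ 2 = 1) (hU : ∀ s ∈ Set.Icc a b, 0 < U s) (hvab : v a = v b)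
    (hK : |K * (u b - u a) / 2| < 1) :
    ∃ s ∈ Set.Icc a b, V s = K * (u s - (u a + u b) / 2) := by
  have hmono : StrictMonoOn u (Set.Icc a b) := by
    refine strictMonoOn_of_deriv_pos (convex_Icc a b)
      (fun s _ => (hu s).continuousAt.continuousWithinAt) fun s hs => ?_
    rw [(hu s).deriv]
    exact hU s (interior_subset hs)
  have ha : a ∈ Set.Icc a b := Set.left_mem_Icc.2 hab.le
  have hb : b ∈ Set.Icc a b := Set.right_mem_Icc.2 hab.le
  rcases eq_or_ne K 0 with rfl | hK0
  · obtain ⟨s, hs, h⟩ := exists_hasDerivAt_eq_zero hab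
      (fun s _ => (hv s).continuousAt.continuousWithinAt) hvab (fun s _ => hv s)
    exact ⟨s, Set.Ioo_subset_Icc_self hs, by simp [h]⟩
  set w : ℝ → ℝ := fun s => K * (u s - (u a + u b) / 2) with hw
  have hwd : ∀ s, HasDerivAt w (K * U s) s := fun s => ((hu s).sub_const _).const_mul K
  have hw1 : ∀ s ∈ Set.Icc a b, 0 < 1 - w s ^ 2 := by
    intro s hs
    have h1 := hmono.monotoneOn ha hs hs.1
    have h2 := hmono.monotoneOn hs hb hs.2
    have h3 : (K * (u b - u a) / 2) ^ 2 < 1 := (sq_lt_one_iff_abs_lt_one _).2 hK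
    have h4 : 0 ≤ K ^ 2 * ((u s - u a) * (u b - u s)) :=
      mul_nonneg (sq_nonneg K) (mul_nonneg (by linarith) (by linarith))
    simp only [hw]
    nlinarith
  have hd : ∀ s ∈ Set.Icc a b, HasDerivAt (fun s => K * v s + √(1 - w s ^ 2))
      (K * V s + (-(2 * w s * (K * U s))) / (2 * √(1 - w s ^ 2))) s := by
    intro s hs
    have h := (((hwd s).pow 2).const_sub 1).sqrt (hw1 s hs).ne'
    exact (((hv s).const_mul K).add h).congr_deriv (by simp)
  obtain ⟨s, hs, h⟩ := exists_hasDerivAt_eq_zero hab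
    (fun s hs => (hd s hs).continuousAt.continuousWithinAt)
    (by
      have : w a ^ 2 = w b ^ 2 := by simp only [hw]; ring
      simp only [this, hvab])
    (fun s hs => hd s (Set.Ioo_subset_Icc_self hs))
  have hs' := Set.Ioo_subset_Icc_self hs
  refine ⟨s, hs', ?_⟩
  change V s = w s
  have hr := Real.sqrt_pos.2 (hw1 s hs')
  have hrsq := Real.sq_sqrt (hw1 s hs').le
  set r := √(1 - w s ^ 2)
  have hpar : V s * r = w s * U s := by
    have h' : K * (V s * r - w s * U s) = 0 := by
      field_simp at h
      linear_combination h
    exact sub_eq_zero.1 ((mul_eq_zero.1 h').resolve_left hK0)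
  have hsq : U s ^ 2 = r ^ 2 := by
    have : (V s * r) ^ 2 = (w s * U s) ^ 2 := by rw [hpar]
    have h1 := hUV s
    have h2 : V s ^ 2 = 1 - U s ^ 2 := by linarith
    have h3 : w s ^ 2 = 1 - r ^ 2 := by linarith
    rw [mul_pow, mul_pow, h2, h3] at this
    linarith
  have hUr : U s = r := (sq_eq_sq₀ (hU s hs').le hr.le).1 hsq
  rw [hUr] at hpar
  exact mul_right_cancel₀ hr.ne' hpar

/-- A unit-speed curve of curvature at most `K`, graph-like over a horizontal chord, makes with the
chord end angles bounded by those of the circular arc of curvature `K`. -/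
theorem slope_bounds_of_curvature_le {u v U V k : ℝ → ℝ} {a b K : ℝ} (hab : a < b)
    (hu : ∀ s, HasDerivAt u (U s) s) (hv : ∀ s, HasDerivAt v (V s) s)
    (hV : ∀ s, HasDerivAt V (k s * U s) s)
    (hUV : ∀ s, U s ^ 2 + V s ^ 2 = 1) (hU : ∀ s ∈ Set.Icc a b, 0 < U s) (hvab : v a = v b)
    (hk : ∀ s ∈ Set.Icc a b, k s ≤ K) :
    -(K * (u b - u a) / 2) ≤ V a ∧ V b ≤ K * (u b - u a) / 2 := by
  have ha : a ∈ Set.Icc a b := Set.left_mem_Icc.2 hab.le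
  have hb : b ∈ Set.Icc a b := Set.right_mem_Icc.2 hab.le
  have hanti : AntitoneOn (fun s => V s - K * u s) (Set.Icc a b) := by
    have hd : ∀ s, HasDerivAt (fun s => V s - K * u s) (k s * U s - K * U s) s :=
      fun s => (hV s).sub ((hu s).const_mul K)
    refine antitoneOn_of_deriv_nonpos (convex_Icc a b)
      (fun s _ => (hd s).continuousAt.continuousWithinAt)
      (fun s _ => (hd s).differentiableAt.differentiableWithinAt) fun s hs => ?_
    rw [(hd s).deriv]
    have hs' := interior_subset hs
    nlinarith [hk s hs', hU s hs']
  have hVlt : ∀ s ∈ Set.Icc a b, |V s| < 1 := fun s hs => by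
    rw [← sq_lt_one_iff_abs_lt_one]
    nlinarith [hUV s, pow_pos (hU s hs) 2]
  have hVa := abs_lt.1 (hVlt a ha)
  have hVb := abs_lt.1 (hVlt b hb)
  have hends := hanti ha hb hab.le
  simp only at hends
  rcases le_or_gt 1 (K * (u b - u a) / 2) with hm | hm
  · constructor <;> linarith
  have hm' : -1 < K * (u b - u a) / 2 := by linarith
  obtain ⟨s, hs, h⟩ := exists_slope_eq_circle_slope hab hu hv hUV hU hvab (abs_lt.2 ⟨hm', hm⟩)
  have h1 := hanti ha hs hs.1
  have h2 := hanti hs hb hs.2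
  simp only [h] at h1 h2
  constructor <;> linarith

theorem real_inner_eq_coords (x y : EuclideanSpace ℝ (Fin 2)) :
    ⟪x, y⟫_ℝ = x 0 * y 0 + x 1 * y 1 := by
  simp [PiLp.inner_apply, Fin.sum_univ_two, mul_comm]

theorem norm_sq_eq_coords (x : EuclideanSpace ℝ (Fin 2)) : ‖x‖ ^ 2 = x 0 ^ 2 + x 1 ^ 2 := by
  rw [← real_inner_self_eq_norm_sq, real_inner_eq_coords]
  ring

theorem HasDerivAt.euclideanSpace_apply {f : ℝ → EuclideanSpace ℝ (Fin 2)}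
    {f' : EuclideanSpace ℝ (Fin 2)} {s : ℝ} (h : HasDerivAt f f' s) (i : Fin 2) :
    HasDerivAt (fun t => f t i) (f' i) s :=
  ((EuclideanSpace.proj i : EuclideanSpace ℝ (Fin 2) →L[ℝ] ℝ).hasFDerivAt).comp_hasDerivAt s h

section UnitSpeed

variable {γ : ℝ → EuclideanSpace ℝ (Fin 2)}

theorem ContDiff.hasDerivAt_deriv (hγ : ContDiff ℝ 2 γ) (s : ℝ) :
    HasDerivAt γ (deriv γ s) s :=
  (hγ.differentiable (by norm_num) s).hasDerivAt

theorem ContDiff.hasDerivAt_deriv_deriv (hγ : ContDiff ℝ 2 γ) (s : ℝ) :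
    HasDerivAt (deriv γ) (deriv (deriv γ) s) s := by
  have h : ContDiff ℝ (1 + 1) γ := by simpa [one_add_one_eq_two] using hγ
  exact ((contDiff_succ_iff_deriv.1 h).2.2.differentiable (by norm_num) s).hasDerivAt

theorem unit_speed_coords (hunit : ∀ s, ‖deriv γ s‖ = 1) (s : ℝ) :
    deriv γ s 0 ^ 2 + deriv γ s 1 ^ 2 = 1 := by
  rw [← norm_sq_eq_coords, hunit, one_pow]

theorem inner_deriv_deriv_eq_zero (hγ : ContDiff ℝ 2 γ) (hunit : ∀ s, ‖deriv γ s‖ = 1) (s : ℝ) :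
    deriv γ s 0 * deriv (deriv γ) s 0 + deriv γ s 1 * deriv (deriv γ) s 1 = 0 := by
  have h0 := (hγ.hasDerivAt_deriv_deriv s).euclideanSpace_apply 0
  have h1 := (hγ.hasDerivAt_deriv_deriv s).euclideanSpace_apply 1
  have h := (h0.pow 2).add (h1.pow 2)
  have hc : ((fun t => deriv γ t 0) ^ 2 + (fun t => deriv γ t 1) ^ 2 : ℝ → ℝ) = fun _ => 1 :=
    funext fun t => unit_speed_coords hunit t
  rw [hc] at h
  have := h.unique (hasDerivAt_const s (1 : ℝ))
  norm_num at this
  linarith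

/-- The circles through the end points of a projectable arc of curvature at most `K`, tangent to
the arc at one of them, have curvature at most `K`. -/
theorem tangent_circle_curvature_le (hγ : ContDiff ℝ 2 γ) (hunit : ∀ s, ‖deriv γ s‖ = 1)
    {a b K : ℝ} (hab : a < b) (hne : γ a ≠ γ b)
    (hproj : ∀ s ∈ Set.Icc a b, 0 < ⟪deriv γ s, γ b - γ a⟫_ℝ)
    (hk : ∀ s ∈ Set.Icc a b, signedCurv γ s ≤ K) :
    2 * det2 (deriv γ a) (γ b - γ a) ≤ K * ‖γ b - γ a‖ ^ 2 ∧
      2 * det2 (γ b - γ a) (deriv γ b) ≤ K * ‖γ b - γ a‖ ^ 2 := by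
  set w := γ b - γ a with hwdef
  have hL : 0 < ‖w‖ := norm_pos_iff.2 (sub_ne_zero.2 hne.symm)
  have hLsq := norm_sq_eq_coords w
  set L := ‖w‖
  have hw0 : w 0 = γ b 0 - γ a 0 := rfl
  have hw1 : w 1 = γ b 1 - γ a 1 := rfl
  have hx := fun s => (hγ.hasDerivAt_deriv s).euclideanSpace_apply 0
  have hy := fun s => (hγ.hasDerivAt_deriv s).euclideanSpace_apply 1
  have hX := fun s => (hγ.hasDerivAt_deriv_deriv s).euclideanSpace_apply 0
  have hY := fun s => (hγ.hasDerivAt_deriv_deriv s).euclideanSpace_apply 1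
  have key := slope_bounds_of_curvature_le (k := signedCurv γ) (K := K) hab
    (u := fun s => (γ s 0 * w 0 + γ s 1 * w 1) / L)
    (v := fun s => (γ s 1 * w 0 - γ s 0 * w 1) / L)
    (U := fun s => (deriv γ s 0 * w 0 + deriv γ s 1 * w 1) / L)
    (V := fun s => (deriv γ s 1 * w 0 - deriv γ s 0 * w 1) / L)
    (fun s => (((hx s).mul_const _).add ((hy s).mul_const _)).div_const L)
    (fun s => (((hy s).mul_const _).sub ((hx s).mul_const _)).div_const L)
    (fun s => ((((hY s).mul_const _).sub ((hX s).mul_const _)).div_const L).congr_deriv (by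
      have h1 := unit_speed_coords hunit s
      have h2 := inner_deriv_deriv_eq_zero hγ hunit s
      simp only [signedCurv, det2]
      rw [← mul_div_assoc]
      congr 1
      linear_combination (-(deriv (deriv γ) s 1 * w 0) + deriv (deriv γ) s 0 * w 1) * h1 +
        (deriv γ s 1 * w 0 - deriv γ s 0 * w 1) * h2))
    (fun s => by
      have h1 := unit_speed_coords hunit s
      field_simp
      linear_combination (w 0 ^ 2 + w 1 ^ 2) * h1 - hLsq)
    (fun s hs => by
      have := hproj s hs
      rw [real_inner_eq_coords] at this
      exact div_pos this hL)
    (by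
      simp only [hw0, hw1]
      ring)
    hk
  have hlen : (γ b 0 * w 0 + γ b 1 * w 1) / L - (γ a 0 * w 0 + γ a 1 * w 1) / L = L := by
    field_simp
    rw [hLsq, hw0, hw1]
    ring
  simp only [hlen] at key
  obtain ⟨h1, h2⟩ := key
  rw [le_div_iff₀ hL] at h1
  rw [div_le_iff₀ hL] at h2
  simp only [det2]
  constructor <;> linarith

theorem deriv_comp_neg_eq : deriv (fun s => γ (-s)) = fun s => -deriv γ (-s) :=
  funext fun s => deriv_comp_neg γ s

theorem signedCurv_comp_neg (s : ℝ) :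
    signedCurv (fun s => γ (-s)) s = -signedCurv γ (-s) := by
  have h : deriv (fun s => -deriv γ (-s)) s = deriv (deriv γ) (-s) := by
    rw [deriv.fun_neg, deriv_comp_neg, neg_neg]
  simp only [signedCurv, deriv_comp_neg_eq, h, det2, PiLp.neg_apply]
  ring

theorem le_tangent_circle_curvature (hγ : ContDiff ℝ 2 γ) (hunit : ∀ s, ‖deriv γ s‖ = 1)
    {a b K : ℝ} (hab : a < b) (hne : γ a ≠ γ b)
    (hproj : ∀ s ∈ Set.Icc a b, 0 < ⟪deriv γ s, γ b - γ a⟫_ℝ)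
    (hk : ∀ s ∈ Set.Icc a b, K ≤ signedCurv γ s) :
    K * ‖γ b - γ a‖ ^ 2 ≤ 2 * det2 (deriv γ a) (γ b - γ a) := by
  have h := (tangent_circle_curvature_le (γ := fun s => γ (-s)) (K := -K) (a := -b) (b := -a)
    (hγ.comp contDiff_neg) (fun s => by simp [deriv_comp_neg_eq, hunit]) (neg_lt_neg hab)
    (by simpa using hne.symm)
    (fun s hs => by
      have := hproj (-s) ⟨by linarith [hs.2], by linarith [hs.1]⟩
      rw [← inner_neg_neg] at this
      simpa [deriv_comp_neg_eq] using this)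
    (fun s hs => by
      rw [signedCurv_comp_neg]
      exact neg_le_neg (hk (-s) ⟨by linarith [hs.2], by linarith [hs.1]⟩))).2
  simp only [deriv_comp_neg_eq, neg_neg, norm_sub_rev (γ a)] at h
  simp only [det2, PiLp.neg_apply, PiLp.sub_apply] at h ⊢
  linarith

/-- Let `c₁`, `c₂` be the curvatures of the circles tangent at a point to a given direction and
passing through a preceding point at displacement `-(p, r)`, respectively a following point at
displacement `(a, b)`. If `c₁ ≤ c₂` and the triangle is not obtuse at the first point, then the
circle through the three points has curvature at most `c₂`. -/
theorem three_point_curvature_le_tangent_circle_curvature {p r a b n₁ n₂ n₃ : ℝ}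
    (hp : 0 < p) (ha : 0 < a) (hn₁ : 0 < n₁) (hn₂ : 0 < n₂) (hn₃ : 0 < n₃)
    (h₁ : n₁ ^ 2 = p ^ 2 + r ^ 2) (h₂ : n₂ ^ 2 = a ^ 2 + b ^ 2)
    (h₃ : n₃ ^ 2 = (p + a) ^ 2 + (r + b) ^ 2)
    (hc : -r / n₁ ^ 2 ≤ b / n₂ ^ 2) (hturn : 0 ≤ n₁ ^ 2 + (p * a + r * b)) :
    2 * (p * b - r * a) / (n₁ * n₂ * n₃) ≤ 2 * b / n₂ ^ 2 := by
  -- Invert in the point of tangency: circles through it become lines.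
  set α := a / n₂ ^ 2 with hα
  set β := b / n₂ ^ 2 with hβ
  set d := α + p / n₁ ^ 2 with hd
  set h := β + r / n₁ ^ 2 with hh
  set D := n₃ / (n₁ * n₂) with hD
  have hα0 : 0 < α := by positivity
  have hd0 : 0 < d := by positivity
  have hD0 : 0 < D := by positivity
  have hh0 : 0 ≤ h := by
    rw [neg_div] at hc
    linarith
  have hDsq : D ^ 2 = d ^ 2 + h ^ 2 := by
    simp only [hD, hd, hh, hα, hβ]
    field_simp
    rw [h₃]
    linear_combination (n₂ ^ 4 - n₁ ^ 2 * n₂ ^ 2) * h₁ + (n₁ ^ 4 - n₁ ^ 2 * n₂ ^ 2) * h₂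
  have hdD : d ≤ D := by nlinarith
  have hfoot : 0 ≤ d * α + h * β := by
    have : d * α + h * β = (n₁ ^ 2 + (p * a + r * b)) / (n₁ ^ 2 * n₂ ^ 2) := by
      simp only [hd, hh, hα, hβ]
      field_simp
      linear_combination (-(n₁ ^ 2)) * h₂
    rw [this]
    positivity
  have hmain : d * β - h * α ≤ β * D := by
    rcases le_or_gt 0 β with hb | hb
    · nlinarith [mul_nonneg hh0 hα0.le]
    · have h1 : -β * (D - d) * (D + d) ≤ h * α * (D + d) := by
        have : -β * (D - d) * (D + d) = h * (-(h * β)) := by linear_combination -β * hDsq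
        rw [this]
        nlinarith [mul_le_mul_of_nonneg_left (show -(h * β) ≤ d * α by linarith) hh0,
          mul_nonneg (mul_nonneg hh0 hα0.le) hD0.le]
      have h2 := le_of_mul_le_mul_right h1 (by linarith)
      linarith
  have hq : 2 * (p * b - r * a) / (n₁ * n₂ * n₃) = 2 * ((d * β - h * α) / D) := by
    simp only [hd, hh, hα, hβ, hD]
    field_simp
    ring
  rw [hq, mul_div_assoc]
  have := (div_le_iff₀ hD0).2 hmain
  linarith

theorem inner_pos_of_inner_normalized_pos {x w : EuclideanSpace ℝ (Fin 2)}
    (h : 0 < ⟪x, ‖w‖⁻¹ • w⟫_ℝ) : 0 < ⟪x, w⟫_ℝ := by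
  rw [inner_smul_right] at h
  exact pos_of_mul_pos_right h (by positivity)

/-- The curvature at the end of a spiral arc is at least its three-point curvature. -/
theorem q3_le_signedCurv (hγ : ContDiff ℝ 2 γ) (hunit : ∀ s, ‖deriv γ s‖ = 1)
    {s₁ s₂ s₃ : ℝ} (h12 : s₁ < s₂) (h23 : s₂ < s₃)
    (hmono : MonotoneOn (signedCurv γ) (Set.Icc s₁ s₃))
    (hne12 : γ s₁ ≠ γ s₂) (hne23 : γ s₂ ≠ γ s₃) (hne13 : γ s₁ ≠ γ s₃)
    (hproj₁ : ∀ s ∈ Set.Icc s₁ s₂, 0 < ⟪deriv γ s, γ s₂ - γ s₁⟫_ℝ)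
    (hproj₂ : ∀ s ∈ Set.Icc s₂ s₃, 0 < ⟪deriv γ s, γ s₃ - γ s₂⟫_ℝ)
    (hturn : 0 ≤ ‖γ s₂ - γ s₁‖ ^ 2 + ⟪γ s₂ - γ s₁, γ s₃ - γ s₂⟫_ℝ) :
    q3 (γ s₁) (γ s₂) (γ s₃) ≤ signedCurv γ s₃ := by
  have hm2 : s₂ ∈ Set.Icc s₁ s₃ := ⟨h12.le, h23.le⟩
  have hm3 : s₃ ∈ Set.Icc s₁ s₃ := ⟨by linarith, le_rfl⟩
  have hc1 := (tangent_circle_curvature_le hγ hunit (K := signedCurv γ s₂) h12 hne12 hproj₁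
    (fun s hs => hmono ⟨hs.1, by linarith [hs.2]⟩ hm2 hs.2)).2
  have hc2 := le_tangent_circle_curvature hγ hunit (K := signedCurv γ s₂) h23 hne23 hproj₂
    (fun s hs => hmono hm2 ⟨by linarith [hs.1], hs.2⟩ hs.1)
  have hc3 := (tangent_circle_curvature_le hγ hunit (K := signedCurv γ s₃) h23 hne23 hproj₂
    (fun s hs => hmono ⟨by linarith [hs.1], hs.2⟩ hm3 hs.2)).1
  have hp := hproj₁ s₂ ⟨h12.le, le_rfl⟩
  have ha := hproj₂ s₂ ⟨le_rfl, h23.le⟩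
  have hsum : γ s₃ - γ s₁ = (γ s₂ - γ s₁) + (γ s₃ - γ s₂) := by abel
  have hn₁ : 0 < ‖γ s₂ - γ s₁‖ := norm_pos_iff.2 (sub_ne_zero.2 hne12.symm)
  have hn₂ : 0 < ‖γ s₃ - γ s₂‖ := norm_pos_iff.2 (sub_ne_zero.2 hne23.symm)
  have hn₃ : 0 < ‖γ s₃ - γ s₁‖ := norm_pos_iff.2 (sub_ne_zero.2 hne13.symm)
  have hT := unit_speed_coords hunit s₂
  have hsq₁ := norm_sq_eq_coords (γ s₂ - γ s₁)
  have hsq₂ := norm_sq_eq_coords (γ s₃ - γ s₂)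
  have hsq₃ := norm_sq_eq_coords (γ s₃ - γ s₁)
  have hs0 : (γ s₃ - γ s₁) 0 = (γ s₂ - γ s₁) 0 + (γ s₃ - γ s₂) 0 := by rw [hsum]; rfl
  have hs1 : (γ s₃ - γ s₁) 1 = (γ s₂ - γ s₁) 1 + (γ s₃ - γ s₂) 1 := by rw [hsum]; rfl
  rw [hs0, hs1] at hsq₃
  rw [real_inner_eq_coords] at hp ha hturn
  unfold q3
  simp only [det2] at hc1 hc2 hc3 ⊢
  clear hs0 hs1 hsum hproj₁ hproj₂
  generalize ‖γ s₂ - γ s₁‖ = n₁ at *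
  generalize ‖γ s₃ - γ s₂‖ = n₂ at *
  generalize ‖γ s₃ - γ s₁‖ = n₃ at *
  generalize γ s₂ - γ s₁ = v at *
  generalize γ s₃ - γ s₂ = w at *
  generalize deriv γ s₂ = t at *
  have key := three_point_curvature_le_tangent_circle_curvature
    (r := t 0 * v 1 - t 1 * v 0) (b := t 0 * w 1 - t 1 * w 0) hp ha hn₁ hn₂ hn₃
    (by linear_combination hsq₁ - (v 0 ^ 2 + v 1 ^ 2) * hT)
    (by linear_combination hsq₂ - (w 0 ^ 2 + w 1 ^ 2) * hT)
    (by linear_combination hsq₃ - ((v 0 + w 0) ^ 2 + (v 1 + w 1) ^ 2) * hT)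
    (by
      refine le_trans (b := signedCurv γ s₂ / 2) ?_ ?_
      · rw [div_le_iff₀ (by positivity)]
        linarith
      · rw [le_div_iff₀ (by positivity)]
        linarith)
    (by
      convert hturn using 2
      linear_combination (v 0 * w 0 + v 1 * w 1) * hT)
  have hdet : (t 0 * v 0 + t 1 * v 1) * (t 0 * w 1 - t 1 * w 0) -
      (t 0 * v 1 - t 1 * v 0) * (t 0 * w 0 + t 1 * w 1) = v 0 * w 1 - v 1 * w 0 := by
    linear_combination (v 0 * w 1 - v 1 * w 0) * hT
  rw [hdet] at key
  refine key.trans ?_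
  rw [div_le_iff₀ (by positivity)]
  exact hc3

end UnitSpeed

/-- The curvature of a spiral at the middle node is bounded by the
neighbouring three-point curvatures:
`q(P₁,P₂,P₃) ≤ k(s₃) ≤ q(P₃,P₄,P₅)`. -/
theorem node_curvature_bounded_by_three_point_curvatures
    (γ : ℝ → EuclideanSpace ℝ (Fin 2)) (hγ : ContDiff ℝ 2 γ)
    (hunit : ∀ s, ‖deriv γ s‖ = 1)
    (s₁ s₂ s₃ s₄ s₅ : ℝ) (h12 : s₁ < s₂) (h23 : s₂ < s₃) (h34 : s₃ < s₄) (h45 : s₄ < s₅)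
    (hmono : MonotoneOn (signedCurv γ) (Set.Icc s₁ s₅))
    (P₁ P₂ P₃ P₄ P₅ : EuclideanSpace ℝ (Fin 2))
    (hP₁ : P₁ = γ s₁) (hP₂ : P₂ = γ s₂) (hP₃ : P₃ = γ s₃) (hP₄ : P₄ = γ s₄)
    (hP₅ : P₅ = γ s₅)
    (hdist : ([P₁, P₂, P₃, P₄, P₅] : List (EuclideanSpace ℝ (Fin 2))).Pairwise (· ≠ ·))
    (v₁ v₂ v₃ v₄ : EuclideanSpace ℝ (Fin 2))
    (hv₁ : v₁ = P₂ - P₁) (hv₂ : v₂ = P₃ - P₂) (hv₃ : v₃ = P₄ - P₃) (hv₄ : v₄ = P₅ - P₄)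
    (hproj₁ : ∀ s ∈ Set.Icc s₁ s₂, 0 < ⟪deriv γ s, ‖v₁‖⁻¹ • v₁⟫_ℝ)
    (hproj₂ : ∀ s ∈ Set.Icc s₂ s₃, 0 < ⟪deriv γ s, ‖v₂‖⁻¹ • v₂⟫_ℝ)
    (hproj₃ : ∀ s ∈ Set.Icc s₃ s₄, 0 < ⟪deriv γ s, ‖v₃‖⁻¹ • v₃⟫_ℝ)
    (hproj₄ : ∀ s ∈ Set.Icc s₄ s₅, 0 < ⟪deriv γ s, ‖v₄‖⁻¹ • v₄⟫_ℝ)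
    (hturn₁ : 0 ≤ ‖v₁‖ ^ 2 + ⟪v₁, v₂⟫_ℝ)
    (hturn₂ : 0 ≤ ‖v₄‖ ^ 2 + ⟪v₃, v₄⟫_ℝ) :
    q3 P₁ P₂ P₃ ≤ signedCurv γ s₃ ∧ signedCurv γ s₃ ≤ q3 P₃ P₄ P₅ := by
  subst hP₁ hP₂ hP₃ hP₄ hP₅ hv₁ hv₂ hv₃ hv₄
  simp only [List.pairwise_cons, List.mem_cons, List.not_mem_nil, or_false, forall_eq_or_imp,
    forall_eq] at hdist
  obtain ⟨⟨h12', h13', -⟩, ⟨h23', -⟩, ⟨h34', h35'⟩, h45', -⟩ := hdist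
  constructor
  · exact q3_le_signedCurv hγ hunit h12 h23
      (hmono.mono (Set.Icc_subset_Icc_right (by linarith))) h12' h23' h13'
      (fun s hs => inner_pos_of_inner_normalized_pos (hproj₁ s hs))
      (fun s hs => inner_pos_of_inner_normalized_pos (hproj₂ s hs)) hturn₁
  · have h := q3_le_signedCurv (γ := fun s => γ (-s)) (s₁ := -s₅) (s₂ := -s₄) (s₃ := -s₃)
      (hγ.comp contDiff_neg) (fun s => by simp [deriv_comp_neg_eq, hunit])
      (neg_lt_neg h45) (neg_lt_neg h34)
      (fun x hx y hy hxy => by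
        simp only [signedCurv_comp_neg]
        exact neg_le_neg (hmono ⟨by linarith [hy.2], by linarith [hy.1]⟩
          ⟨by linarith [hx.2], by linarith [hx.1]⟩ (neg_le_neg hxy)))
      (by simpa using h45'.symm) (by simpa using h34'.symm) (by simpa using h35'.symm)
      (fun s hs => by
        have := inner_pos_of_inner_normalized_pos
          (hproj₄ (-s) ⟨by linarith [hs.2], by linarith [hs.1]⟩)
        rw [← inner_neg_neg] at this
        simpa [deriv_comp_neg_eq] using this)
      (fun s hs => by
        have := inner_pos_of_inner_normalized_pos
          (hproj₃ (-s) ⟨by linarith [hs.2], by linarith [hs.1]⟩)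
        rw [← inner_neg_neg] at this
        simpa [deriv_comp_neg_eq] using this)
      (by
        rw [real_inner_comm, ← inner_neg_neg, ← norm_neg (γ s₅ - γ s₄)] at hturn₂
        simpa using hturn₂)
    rw [signedCurv_comp_neg] at h
    simp only [neg_neg] at h
    have hrev : q3 (γ s₅) (γ s₄) (γ s₃) = -q3 (γ s₃) (γ s₄) (γ s₅) := by
      simp only [q3, norm_sub_rev (γ s₄) (γ s₅), norm_sub_rev (γ s₃), det2, PiLp.sub_apply]
      rw [mul_comm ‖γ s₅ - γ s₄‖, ← neg_div]
      congr 1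
      ring
    rw [hrev] at h
    exact neg_le_neg_iff.1 h
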